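/- Let M be a definite multi-context system admitting a stratification 𝔖_0,…,𝔖_l. Define a belief state S by recursion on the stratum index: for each context C_i in stratum 𝔖_k, set S_i = ACC_i {head(r) | r ∈ br_i and r is satisfied with respect to the already-computed belief sets of the contexts in strata 𝔖_0,…,𝔖_{k-1}} (this is well defined since all body literals of rules of C_i refer to contexts in strictly lower strata). Then S is the grounded equilibrium of M. -/

import Mathlib

/-- A bridge rule of a definite MCS: a head literal and a finite positive body. -/
structure Rule (n : ℕ) (α : Type*) where
  head : α
  body : Finset (Fin n × α)
deriving DecidableEq

/-- A definite multi-context system: for each context, a monotone semantic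
operator and a finite set of bridge rules. -/
structure MCS (n : ℕ) (α : Type*) [DecidableEq α] where
  ACC : Fin n → Finset α → Finset α
  mono : ∀ i, Monotone (ACC i)
  br : Fin n → Finset (Rule n α)

variable {n : ℕ} {α : Type*} [DecidableEq α]

/-- A bridge rule is satisfied in a belief state `S` iff every body literal holds. -/
def Satisfied (r : Rule n α) (S : Fin n → Finset α) : Prop :=
  ∀ cp ∈ r.body, cp.2 ∈ S cp.1

instance (r : Rule n α) (S : Fin n → Finset α) : Decidable (Satisfied r S) := by
  unfold Satisfied; infer_instance

/-- The knowledge base induced at context `i` by belief state `S`: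
the heads of the bridge rules of context `i` satisfied in `S`. -/
def kbOf (M : MCS n α) (S : Fin n → Finset α) (i : Fin n) : Finset α :=
  ((M.br i).filter (fun r => Satisfied r S)).image Rule.head

/-- A belief state is an equilibrium iff each belief set is the result of
applying the semantic operator to the induced knowledge base. -/
def IsEquilibrium (M : MCS n α) (S : Fin n → Finset α) : Prop :=
  ∀ i, S i = M.ACC i (kbOf M S i)

/-- The grounded equilibrium: the pointwise-⊆-least equilibrium. -/
def IsGrounded (M : MCS n α) (S : Fin n → Finset α) : Prop :=
  IsEquilibrium M S ∧ ∀ E, IsEquilibrium M E → ∀ i, S i ⊆ E i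

/-- `M'` is a fragment of `M`: same contexts and operators, fewer bridge rules. -/
def Fragment (M' M : MCS n α) : Prop :=
  M'.ACC = M.ACC ∧ ∀ i, M'.br i ⊆ M.br i

/-- `strat` (a list of strata `𝔖_0, …,𝔖_l`) is a stratification of `M`: the strata
partition the set of contexts (each context lies in exactly one stratum), and every
body literal of every bridge rule of a context in stratum `k` refers to a context
lying in some strictly lower stratum. -/
def IsStratification (M : MCS n α) (l : ℕ) (strat : Fin (l + 1) → Finset (Fin n)) : Prop :=
  (∀ i : Fin n, ∃! k : Fin (l + 1), i ∈ strat k) ∧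
  ∀ (k : Fin (l + 1)) (i : Fin n), i ∈ strat k →
    ∀ r ∈ M.br i, ∀ cp ∈ r.body, ∃ k' : Fin (l + 1), k' < k ∧ cp.1 ∈ strat k'

/-- The knowledge base of context `i` is monotone in the belief sets of those contexts
that its bridge rules refer to. -/
theorem kbOf_subset_kbOf (M : MCS n α) {S T : Fin n → Finset α} {i : Fin n}
    (h : ∀ r ∈ M.br i, ∀ cp ∈ r.body, S cp.1 ⊆ T cp.1) : kbOf M S i ⊆ kbOf M T i := by
  refine Finset.image_subset_image fun r hr => ?_
  rw [Finset.mem_filter] at hr ⊢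
  exact ⟨hr.1, fun cp hcp => h r hr.1 cp hcp (hr.2 cp hcp)⟩

/-- In a stratified MCS, every equilibrium is contained in every other one. -/
theorem IsStratification.equilibrium_subset {M : MCS n α} {l : ℕ}
    {strat : Fin (l + 1) → Finset (Fin n)} (hstrat : IsStratification M l strat)
    {S E : Fin n → Finset α} (hS : IsEquilibrium M S) (hE : IsEquilibrium M E) (i : Fin n) :
    S i ⊆ E i := by
  have key : ∀ k : Fin (l + 1), ∀ i ∈ strat k, S i ⊆ E i := by
    intro k
    induction k using WellFoundedLT.induction with
    | ind k ih =>
      intro i hi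
      rw [hS i, hE i]
      refine M.mono i (kbOf_subset_kbOf M fun r hr cp hcp => ?_)
      obtain ⟨k', hk', hmem⟩ := hstrat.2 k i hi r hr cp hcp
      exact ih k' hk' cp.1 hmem
  obtain ⟨k, hk, -⟩ := hstrat.1 i
  exact key k i hk

/-- given a stratification of `M`, the belief state `S` defined by
recursion on the stratum index — for a context `i` in stratum `k`,
`S i = ACC_i {head r | r ∈ br i satisfied w.r.t. the already-computed belief sets
of the contexts in strictly lower strata}` — is the grounded equilibrium of `M`. -/
theorem stratified_recursion_computes_grounded_equilibrium (M : MCS n α)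
    (l : ℕ) (strat : Fin (l + 1) → Finset (Fin n))
    (hstrat : IsStratification M l strat)
    (S : Fin n → Finset α)
    (hdef : ∀ (k : Fin (l + 1)) (i : Fin n), i ∈ strat k →
        S i = M.ACC i (((M.br i).filter (fun r =>
          Satisfied r (fun j => if ∃ k' : Fin (l + 1), k' < k ∧ j ∈ strat k'
                                then S j else ∅))).image Rule.head)) :
    IsGrounded M S := by
  have hS : IsEquilibrium M S := by
    intro i
    obtain ⟨k, hk, -⟩ := hstrat.1 i
    refine (hdef k i hk).trans (congrArg (M.ACC i) (Finset.Subset.antisymm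
      (kbOf_subset_kbOf M fun r hr cp hcp => ?_) (kbOf_subset_kbOf M fun r hr cp hcp => ?_)))
    all_goals rw [if_pos (hstrat.2 k i hk r hr cp hcp)]
  exact ⟨hS, fun E hE => hstrat.equilibrium_subset hS hE⟩
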